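/- Let F ⊆ V be a free set with |F| ≥ 2, and let f ∈ F be such that removing f does not change the minimum free degree, i.e. min_{v∈F∖{f}} d(v) = min_{v∈F} d(v). Then λ₁(L_{F∖{f}}) > λ₁(L_F): pinning one additional node while keeping the minimum free degree unchanged strictly increases the smallest eigenvalue of the grounded annealed Laplacian. -/

import Mathlib

open Finset

noncomputable def groundedLaplacian {V : Type*} [Fintype V] [DecidableEq V]
    (d : V → ℝ) (F : Finset V) : Matrix {v // v ∈ F} {v // v ∈ F} ℝ :=
  fun u v => (if u = v then d u.1 else 0) - d u.1 * d v.1 / (∑ w, d w)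

theorem groundedLaplacian_isHermitian {V : Type*} [Fintype V] [DecidableEq V]
    (d : V → ℝ) (F : Finset V) : (groundedLaplacian d F).IsHermitian := by
  ext u v
  rcases eq_or_ne u v with rfl | h
  · simp [groundedLaplacian, Matrix.conjTranspose_apply]
  · simp [groundedLaplacian, Matrix.conjTranspose_apply, h, Ne.symm h, mul_comm]

/-- Smallest eigenvalue of the grounded annealed Laplacian. -/
noncomputable def lambda1 {V : Type*} [Fintype V] [DecidableEq V]
    (d : V → ℝ) (F : Finset V) : ℝ :=
  ⨅ i, (groundedLaplacian_isHermitian d F).eigenvalues i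

theorem groundedLaplacian_mulVec {V : Type*} [Fintype V] [DecidableEq V]
    (d : V → ℝ) (F : Finset V) (z : V → ℝ) (u : {v // v ∈ F}) :
    (groundedLaplacian d F).mulVec (fun v => z v) u
      = d u * z u - d u * (∑ v ∈ F, d v * z v) / ∑ w, d w := by
  simp only [Matrix.mulVec, dotProduct, groundedLaplacian, sub_mul, ite_mul, zero_mul,
    Finset.sum_sub_distrib, Finset.sum_ite_eq, Finset.mem_univ, if_true]
  rw [← Finset.sum_coe_sort F, Finset.mul_sum, Finset.sum_div]
  congr 1
  refine Finset.sum_congr rfl fun v _ => ?_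
  ring

theorem Matrix.IsHermitian.posSemidef_sub_smul_one {n : Type*} [Fintype n] [DecidableEq n]
    {A : Matrix n n ℝ} (hA : A.IsHermitian) {c : ℝ} (hc : ∀ i, c ≤ hA.eigenvalues i) :
    (A - c • (1 : Matrix n n ℝ)).PosSemidef := by
  rw [Matrix.posSemidef_iff_isHermitian_and_spectrum_nonneg]
  refine ⟨hA.sub (Matrix.isHermitian_one.smul (IsSelfAdjoint.all c)), fun x hx => ?_⟩
  rw [← Algebra.algebraMap_eq_smul_one, ← spectrum.sub_singleton_eq,
    hA.spectrum_real_eq_range_eigenvalues] at hx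
  obtain ⟨_, ⟨i, rfl⟩, _, rfl, rfl⟩ := hx
  exact sub_nonneg.mpr (hc i)

/-- The Rayleigh quotient bound for `lambda1`. -/
theorem lambda1_mul_le {V : Type*} [Fintype V] [DecidableEq V]
    (d : V → ℝ) (F : Finset V) (z : V → ℝ) :
    lambda1 d F * ∑ v ∈ F, z v ^ 2
      ≤ ∑ v ∈ F, d v * z v ^ 2 - (∑ v ∈ F, d v * z v) ^ 2 / ∑ w, d w := by
  have h := ((groundedLaplacian_isHermitian d F).posSemidef_sub_smul_one
    (c := lambda1 d F) fun i =>
      ciInf_le (Set.finite_range _).bddBelow i).dotProduct_mulVec_nonneg (fun v => z v)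
  have e : star (fun v : {v // v ∈ F} => z v) ⬝ᵥ
      ((groundedLaplacian d F - lambda1 d F • 1).mulVec (fun v => z v))
      = ∑ v ∈ F, (z v * (d v * z v - d v * (∑ v ∈ F, d v * z v) / ∑ w, d w)
        - lambda1 d F * z v ^ 2) := by
    rw [← Finset.sum_coe_sort F, dotProduct]
    refine Finset.sum_congr rfl fun v _ => ?_
    simp only [Matrix.sub_mulVec, Matrix.smul_mulVec, Matrix.one_mulVec, Pi.sub_apply,
      groundedLaplacian_mulVec, Pi.smul_apply, smul_eq_mul, star_trivial]
    ring
  rw [e, Finset.sum_sub_distrib, ← Finset.mul_sum] at h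
  have e' : ∑ v ∈ F, z v * (d v * z v - d v * (∑ v ∈ F, d v * z v) / ∑ w, d w)
      = ∑ v ∈ F, d v * z v ^ 2 - (∑ v ∈ F, d v * z v) ^ 2 / ∑ w, d w := by
    rw [sq (∑ v ∈ F, d v * z v), mul_div_assoc, Finset.sum_mul, ← Finset.sum_sub_distrib]
    refine Finset.sum_congr rfl fun v _ => ?_
    ring
  linarith

theorem exists_eigenvector_lambda1 {V : Type*} [Fintype V] [DecidableEq V]
    (d : V → ℝ) {F : Finset V} (hF : F.Nonempty) :
    ∃ z : V → ℝ, (∃ v ∈ F, z v ≠ 0) ∧ ∀ u ∈ F,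
      d u * z u - d u * (∑ v ∈ F, d v * z v) / ∑ w, d w = lambda1 d F * z u := by
  have : Nonempty {v // v ∈ F} := hF.to_subtype
  have hA := groundedLaplacian_isHermitian d F
  obtain ⟨i, hi⟩ := exists_eq_ciInf_of_finite (f := hA.eigenvalues)
  set x : {v // v ∈ F} → ℝ := ⇑(hA.eigenvectorBasis i) with hx
  let z : V → ℝ := fun v => if h : v ∈ F then x ⟨v, h⟩ else 0
  have hz : (fun v : {v // v ∈ F} => z v) = x := by
    funext v
    simp [z]
  have hne : x ≠ 0 := fun h => hA.eigenvectorBasis.toBasis.ne_zero i (by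
    ext v
    simpa using congrFun h v)
  refine ⟨z, ?_, fun u hu => ?_⟩
  · obtain ⟨v, hv⟩ := Function.ne_iff.mp hne
    exact ⟨v, v.2, by rw [← hz] at hv; exact hv⟩
  · have h := congrFun (hA.mulVec_eigenvectorBasis i) ⟨u, hu⟩
    rw [← hx, ← hz, groundedLaplacian_mulVec] at h
    rw [h, hi]
    rfl

/-- let `F ⊆ V` with `|F| ≥ 2` and `f ∈ F` be such that removing `f` does not
change the minimum free degree. Then `λ₁(L_{F∖{f}}) > λ₁(L_F)`. -/
theorem stmt_5 {V : Type*} [Fintype V] [DecidableEq V] [Nonempty V]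
    (d : V → ℝ) (hd : ∀ v, 0 < d v)
    (F : Finset V) (hF : F.Nonempty) (h2 : 2 ≤ F.card)
    (f : V) (hfF : f ∈ F)
    (hmin : (F.erase f).inf'
        (Finset.card_pos.mp (by rw [Finset.card_erase_of_mem hfF]; omega)) d
      = F.inf' hF d) :
    lambda1 d F < lambda1 d (F.erase f) := by
  have hK : 0 < ∑ w, d w := Finset.sum_pos (fun v _ => hd v) Finset.univ_nonempty
  have hF' : (F.erase f).Nonempty :=
    Finset.card_pos.mp (by rw [Finset.card_erase_of_mem hfF]; omega)
  obtain ⟨z, ⟨v, hv, hzv⟩, hz⟩ := exists_eigenvector_lambda1 d hF'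
  by_contra! hle
  have hN : ∑ u ∈ F.erase f, d u * z u ^ 2 - (∑ u ∈ F.erase f, d u * z u) ^ 2 / ∑ w, d w
      = lambda1 d (F.erase f) * ∑ u ∈ F.erase f, z u ^ 2 := by
    rw [sq (∑ u ∈ F.erase f, d u * z u), mul_div_assoc, Finset.sum_mul,
      ← Finset.sum_sub_distrib, Finset.mul_sum]
    refine Finset.sum_congr rfl fun u hu => ?_
    linear_combination z u * hz u hu
  set s := ∑ u ∈ F.erase f, d u * z u
  have hupd : ∀ (t : ℝ), ∀ u ∈ F.erase f, Function.update z f t u = z u := fun t u hu =>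
    Function.update_of_ne (Finset.ne_of_mem_erase hu) t z
  have hquad : ∀ t : ℝ, 0 ≤ (d f - d f ^ 2 / (∑ w, d w) - lambda1 d F) * (t * t)
      + (-2 * s * d f / ∑ w, d w) * t + 0 := fun t => by
    have h := lambda1_mul_le d F (Function.update z f t)
    rw [← Finset.add_sum_erase F _ hfF, ← Finset.add_sum_erase F _ hfF,
      ← Finset.add_sum_erase F _ hfF,
      Finset.sum_congr (g := fun u => z u ^ 2) rfl fun u hu => congrArg (· ^ 2) (hupd t u hu),
      Finset.sum_congr (g := fun u => d u * z u ^ 2) rfl fun u hu =>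
        congrArg (d u * · ^ 2) (hupd t u hu),
      Finset.sum_congr (g := fun u => d u * z u) rfl fun u hu =>
        congrArg (d u * ·) (hupd t u hu),
      Function.update_self] at h
    have h0 := mul_le_mul_of_nonneg_right hle
      (Finset.sum_nonneg fun u (_ : u ∈ F.erase f) => sq_nonneg (z u))
    have e : (d f * t + s) ^ 2 / (∑ w, d w) = s ^ 2 / (∑ w, d w)
        + d f ^ 2 / (∑ w, d w) * (t * t) - (-2 * s * d f / ∑ w, d w) * t := by ring
    change _ ≤ _ - (d f * t + s) ^ 2 / (∑ w, d w) at h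
    rw [e] at h
    linarith
  have hs : s = 0 := by
    have h := discrim_le_zero hquad
    rw [discrim, mul_zero, sub_zero] at h
    have h' := pow_eq_zero_iff two_ne_zero |>.mp (le_antisymm h (sq_nonneg _))
    simpa [hK.ne', (hd f).ne'] using h'
  have hdv : d v = lambda1 d (F.erase f) := by
    have h := hz v hv
    rw [hs, mul_zero, zero_div, sub_zero] at h
    exact mul_right_cancel₀ hzv h
  have h := lambda1_mul_le d (F.erase f) (Pi.single v 1)
  simp only [Pi.single_apply, ite_pow, one_pow, ne_eq, OfNat.ofNat_ne_zero, not_false_eq_true,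
    zero_pow, mul_ite, mul_one, mul_zero, Finset.sum_ite_eq', hv, if_true] at h
  have := div_pos (pow_pos (hd v) 2) hK
  linarith
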